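/- Let g : ℍ → ℂ be an injective holomorphic map with g(z+1) = g(z)+1, let h be the induced univalent map on the unit disk with h(0)=0 (via h(exp(2πiz)) = exp(2πig(z))), and let α ∈ ℂ satisfy exp(-2πi α) = h'(0). Then every w ∈ ℂ with Im w > (log 2)/π - Im α lies in the image g(ℍ). -/

import Mathlib

section KoebeQuarter
open MeasureTheory Set Filter Topology

theorem KQ.circle_lower (φ : ℂ → ℂ) (hφ : DifferentiableOn ℂ φ (Metric.ball 0 1)) (r : ℝ)
    (hr0 : 0 < r) (hr1 : r < 1) :
    ENNReal.ofReal (2 * Real.pi * ((r ^ 4)⁻¹ + ‖φ 0‖ ^ 2)) ≤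
      ∫⁻ θ in Ioo (-Real.pi) Real.pi,
        ENNReal.ofReal (‖-((circleMap 0 r θ) ^ 2)⁻¹ + φ (circleMap 0 r θ)‖ ^ 2) := by
  set b := φ 0 with hb
  let H : ℂ → ℂ := fun z => ((r : ℂ) ^ 4)⁻¹ - 2 * ((r : ℂ) ^ 4)⁻¹ * (z ^ 2 * φ z)
    + 2 * (starRingEnd ℂ b) * φ z - (‖b‖ : ℂ) ^ 2
  have hHd : DifferentiableOn ℂ H (Metric.ball 0 1) := by
    have : DifferentiableOn ℂ (fun z : ℂ => z ^ 2) (Metric.ball 0 1) := by fun_prop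
    fun_prop
  have hmean := (DiffContOnCl.circleAverage (c := 0) (R := r) (f := H)
    ⟨hHd.mono (Metric.ball_subset_ball (by rw [abs_of_pos hr0]; exact hr1.le)), by
      rw [closure_ball _ (by positivity), abs_of_pos hr0]
      exact hHd.continuousOn.mono (Metric.closedBall_subset_ball hr1)⟩)
  have hH0 : H 0 = (((r ^ 4)⁻¹ + ‖b‖ ^ 2 : ℝ) : ℂ) := by
    have : (starRingEnd ℂ b) * b = (‖b‖ : ℂ) ^ 2 := by
      rw [Complex.conj_mul']
    simp only [H, ← hb]
    push_cast
    linear_combination 2 * this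
  have hmem : ∀ θ, circleMap 0 r θ ∈ Metric.ball (0 : ℂ) 1 := fun θ => by
    simp [abs_of_pos hr0, hr1]
  have hcm : Continuous (circleMap 0 r) := continuous_circleMap 0 r
  have hcont : Continuous fun θ => H (circleMap 0 r θ) :=
    hHd.continuousOn.comp_continuous hcm hmem
  have hφc : Continuous fun θ => φ (circleMap 0 r θ) :=
    hφ.continuousOn.comp_continuous hcm hmem
  have hne : ∀ θ, circleMap 0 r θ ≠ 0 := fun θ => circleMap_ne_center hr0.ne'
  have hgc : Continuous fun θ => ‖-((circleMap 0 r θ) ^ 2)⁻¹ + φ (circleMap 0 r θ)‖ ^ 2 := by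
    have : Continuous fun θ => ((circleMap 0 r θ) ^ 2)⁻¹ :=
      (hcm.pow 2).inv₀ (fun θ => pow_ne_zero _ (hne θ))
    exact ((this.neg.add hφc).norm).pow 2
  have hle : ∀ θ, (H (circleMap 0 r θ)).re ≤
      ‖-((circleMap 0 r θ) ^ 2)⁻¹ + φ (circleMap 0 r θ)‖ ^ 2 := by
    intro θ
    set z := circleMap 0 r θ with hz
    have hzr : ‖z‖ = r := by simp [hz, abs_of_pos hr0]
    have hconj : z * starRingEnd ℂ z = (r : ℂ) ^ 2 := by
      rw [Complex.mul_conj', hzr]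
    have hr' : (r : ℂ) ≠ 0 := by exact_mod_cast hr0.ne'
    have hinv : starRingEnd ℂ ((z ^ 2)⁻¹) = ((r : ℂ) ^ 4)⁻¹ * z ^ 2 := by
      have h0 := hne θ
      rw [← hz] at h0
      have h1 : starRingEnd ℂ z ≠ 0 := by simpa using h0
      rw [map_inv₀, map_pow]
      field_simp
      rw [show (r : ℂ) ^ 4 = ((r : ℂ) ^ 2) ^ 2 by ring, ← hconj]; ring
    have e1 : ‖-(z ^ 2)⁻¹ + φ z‖ ^ 2 = (r ^ 4)⁻¹ + ‖φ z‖ ^ 2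
        - 2 * (((r : ℂ) ^ 4)⁻¹ * z ^ 2 * φ z).re := by
      rw [← hinv]
      have h4 : ‖(z ^ 2)⁻¹‖ ^ 2 = (r ^ 4)⁻¹ := by
        rw [norm_inv, norm_pow, hzr, inv_pow]; ring
      rw [← h4]
      generalize (z ^ 2)⁻¹ = u
      simp only [← Complex.normSq_eq_norm_sq, Complex.normSq_apply]
      simp
      ring
    have e2 : 0 ≤ ‖φ z‖ ^ 2 - 2 * (starRingEnd ℂ b * φ z).re + ‖b‖ ^ 2 := by
      have : ‖φ z - b‖ ^ 2 = ‖φ z‖ ^ 2 - 2 * (starRingEnd ℂ b * φ z).re + ‖b‖ ^ 2 := by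
        simp only [← Complex.normSq_eq_norm_sq, Complex.normSq_apply]
        simp
        ring
      rw [← this]; positivity
    have e3 : (H z).re = (r ^ 4)⁻¹ - 2 * (((r : ℂ) ^ 4)⁻¹ * z ^ 2 * φ z).re
        + 2 * (starRingEnd ℂ b * φ z).re - ‖b‖ ^ 2 := by
      have : H z = (((r ^ 4)⁻¹ - ‖b‖ ^ 2 : ℝ) : ℂ) + ((2 : ℝ) : ℂ) * (-(((r : ℂ) ^ 4)⁻¹ * z ^ 2 * φ z)
        + (starRingEnd ℂ b * φ z)) := by
        simp only [H]; push_cast; ring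
      rw [this, Complex.add_re, Complex.ofReal_re, Complex.re_ofReal_mul, Complex.add_re, Complex.neg_re]
      ring
    rw [e1, e3]; linarith
  have hper : Function.Periodic (fun θ => H (circleMap 0 r θ)) (2 * Real.pi) := by
    intro θ; simp only [periodic_circleMap 0 r θ]
  have hint : ∫ θ in (-Real.pi)..Real.pi, (H (circleMap 0 r θ)).re =
      2 * Real.pi * ((r ^ 4)⁻¹ + ‖b‖ ^ 2) := by
    have h1 := hper.intervalIntegral_add_eq (-Real.pi) 0
    rw [show -Real.pi + 2 * Real.pi = Real.pi by ring, zero_add] at h1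
    rw [Real.circleAverage_def, ← h1, hH0] at hmean
    have h2 : ∫ θ in (-Real.pi)..Real.pi, H (circleMap 0 r θ) =
      ((2 * Real.pi * ((r ^ 4)⁻¹ + ‖b‖ ^ 2) : ℝ) : ℂ) := by
      have hpi : (Real.pi : ℂ) ≠ 0 := by exact_mod_cast Real.pi_ne_zero
      have h3 : (2 * Real.pi)⁻¹ • (∫ θ in (-Real.pi)..Real.pi, H (circleMap 0 r θ)) =
        ((2 * Real.pi : ℝ) : ℂ)⁻¹ * ∫ θ in (-Real.pi)..Real.pi, H (circleMap 0 r θ) := by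
        rw [Complex.real_smul]; push_cast; rfl
      rw [h3] at hmean
      rw [inv_mul_eq_iff_eq_mul₀ (by exact_mod_cast Real.two_pi_pos.ne')] at hmean
      rw [hmean]; push_cast; ring
    have h4 := intervalIntegral.intervalIntegral_re (𝕜 := ℂ)
      (hcont.intervalIntegrable (μ := volume) (-Real.pi) Real.pi)
    simp only [RCLike.re_to_complex] at h4
    rw [h4, h2, Complex.ofReal_re]
  have hpp : -Real.pi ≤ Real.pi := by linarith [Real.pi_pos]
  rw [← hint]
  have hre : Continuous fun θ => (H (circleMap 0 r θ)).re := Complex.continuous_re.comp hcont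
  calc _ ≤ ENNReal.ofReal (∫ θ in (-Real.pi)..Real.pi,
        ‖-((circleMap 0 r θ) ^ 2)⁻¹ + φ (circleMap 0 r θ)‖ ^ 2) := by
        apply ENNReal.ofReal_le_ofReal
        exact intervalIntegral.integral_mono_on hpp (hre.intervalIntegrable _ _)
          (hgc.intervalIntegrable _ _) (fun θ _ => hle θ)
    _ = _ := by
        rw [intervalIntegral.integral_of_le hpp, integral_Ioc_eq_integral_Ioo,
          ofReal_integral_eq_lintegral_ofReal]
        · exact (hgc.integrableOn_Icc (a := -Real.pi) (b := Real.pi)).mono_set Ioo_subset_Icc_self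
        · exact Eventually.of_forall fun θ => by positivity

theorem KQ.annulus_lower (φ : ℂ → ℂ) (hφ : DifferentiableOn ℂ φ (Metric.ball 0 1)) (ρ R : ℝ)
    (hρ : 0 < ρ) (hρR : ρ < R) (hR : R < 1) :
    ENNReal.ofReal (Real.pi * ((ρ ^ 2)⁻¹ - (R ^ 2)⁻¹ + (R ^ 2 - ρ ^ 2) * ‖φ 0‖ ^ 2)) ≤
      ∫⁻ z in {z : ℂ | ρ < ‖z‖ ∧ ‖z‖ < R}, ENNReal.ofReal (‖-(z ^ 2)⁻¹ + φ z‖ ^ 2) := by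
  set A : Set ℂ := {z : ℂ | ρ < ‖z‖ ∧ ‖z‖ < R} with hA
  have hAo : IsOpen A := (isOpen_lt continuous_const continuous_norm).inter
    (isOpen_lt continuous_norm continuous_const)
  set F : ℂ → ENNReal := fun z => ENNReal.ofReal (‖-(z ^ 2)⁻¹ + φ z‖ ^ 2) with hF
  have hFc : ContinuousOn F A := by
    apply ENNReal.continuous_ofReal.comp_continuousOn
    have h1 : ContinuousOn (fun z : ℂ => (z ^ 2)⁻¹) A := by
      apply ContinuousOn.inv₀ (by fun_prop)
      rintro z ⟨hz, -⟩
      exact pow_ne_zero _ (norm_pos_iff.1 (hρ.trans hz))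
    have h2 : ContinuousOn φ A := hφ.continuousOn.mono (by
      rintro z ⟨-, hz⟩; simpa using hz.trans hR)
    fun_prop
  have hFm : Measurable (A.indicator F) := by
    classical
    have := hFc.measurable_piecewise (g := fun _ => 0) continuousOn_const hAo.measurableSet
    exact (Set.piecewise_eq_indicator (f := F) (s := A)) ▸ this
  rw [← lintegral_indicator hAo.measurableSet, ← Complex.lintegral_comp_polarCoord_symm,
    polarCoord_target, Measure.volume_eq_prod, ← Measure.prod_restrict, lintegral_prod]
  swap
  · apply Measurable.aemeasurable
    refine (ENNReal.measurable_ofReal.comp measurable_fst).smul (hFm.comp ?_)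
    have : (Complex.polarCoord.symm : ℝ × ℝ → ℂ) =
      fun p : ℝ × ℝ => (p.1 * (Real.cos p.2 + Real.sin p.2 * Complex.I) : ℂ) := by
      ext p; rw [Complex.polarCoord_symm_apply]
    rw [this]
    apply Continuous.measurable
    fun_prop
  have hps : ∀ r θ : ℝ, Complex.polarCoord.symm (r, θ) = circleMap 0 r θ := by
    intro r θ
    rw [Complex.polarCoord_symm_apply, circleMap, Complex.exp_mul_I]
    push_cast; ring
  calc _ = ∫⁻ r in Ioo ρ R, ENNReal.ofReal (r * (2 * Real.pi * ((r ^ 4)⁻¹ + ‖φ 0‖ ^ 2))) := by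
        have hder : ∀ x ∈ uIcc ρ R, HasDerivAt
            (fun x : ℝ => Real.pi * (-(x ^ 2)⁻¹ + x ^ 2 * ‖φ 0‖ ^ 2))
            (x * (2 * Real.pi * ((x ^ 4)⁻¹ + ‖φ 0‖ ^ 2))) x := by
          intro x hx
          rw [uIcc_of_le hρR.le] at hx
          have hx0 : x ≠ 0 := (hρ.trans_le hx.1).ne'
          have := ((((hasDerivAt_pow 2 x).inv (pow_ne_zero 2 hx0)).neg).add
            ((hasDerivAt_pow 2 x).mul_const (‖φ 0‖ ^ 2))).const_mul Real.pi
          convert! this using 1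
          field_simp
          norm_num
          ring
        have hc : ContinuousOn (fun x : ℝ => x * (2 * Real.pi * ((x ^ 4)⁻¹ + ‖φ 0‖ ^ 2)))
            (Icc ρ R) := by
          have : ContinuousOn (fun x : ℝ => (x ^ 4)⁻¹) (Icc ρ R) := by
            apply ContinuousOn.inv₀ (by fun_prop)
            intro x hx
            exact pow_ne_zero _ (hρ.trans_le hx.1).ne'
          fun_prop
        have := intervalIntegral.integral_eq_sub_of_hasDerivAt hder
          (hc.intervalIntegrable_of_Icc hρR.le)
        rw [intervalIntegral.integral_of_le hρR.le, integral_Ioc_eq_integral_Ioo] at this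
        rw [← ofReal_integral_eq_lintegral_ofReal, this]
        · congr 1; ring
        · exact (hc.integrableOn_Icc).mono_set Ioo_subset_Icc_self
        · refine (ae_restrict_iff' measurableSet_Ioo).2 (Eventually.of_forall fun x hx => ?_)
          have : 0 < x := hρ.trans hx.1
          have := Real.pi_pos
          simp only [Pi.zero_apply]
          positivity
    _ ≤ ∫⁻ r in Ioo ρ R, ∫⁻ θ in Ioo (-Real.pi) Real.pi,
          ENNReal.ofReal r • A.indicator F (Complex.polarCoord.symm (r, θ)) := by
        apply setLIntegral_mono' measurableSet_Ioo
        intro r hr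
        have hr0 : 0 < r := hρ.trans hr.1
        rw [ENNReal.ofReal_mul hr0.le]
        simp only [smul_eq_mul]
        rw [lintegral_const_mul' _ _ ENNReal.ofReal_ne_top]
        gcongr
        refine (KQ.circle_lower φ hφ r hr0 (hr.2.trans hR)).trans (le_of_eq ?_)
        apply lintegral_congr
        intro θ
        rw [hps, indicator_of_mem]
        simpa [hA, abs_of_pos hr0] using hr
    _ ≤ _ := lintegral_mono_set (fun r hr => hρ.trans hr.1)

theorem KQ.preconn_outer (S : ℝ) (hS : 0 < S) : IsPreconnected {ζ : ℂ | S < ‖ζ‖} := by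
  have : {ζ : ℂ | S < ‖ζ‖} = (fun p : ℝ × ℝ => circleMap 0 p.1 p.2) '' (Ioi S ×ˢ univ) := by
    ext ζ
    constructor
    · intro h
      refine ⟨(‖ζ‖, ζ.arg), ⟨h, mem_univ _⟩, ?_⟩
      simp [circleMap]
    · rintro ⟨⟨r, θ⟩, ⟨hr, -⟩, rfl⟩
      have hr' : S < r := hr
      simpa [abs_of_pos (hS.trans hr')] using hr'
  rw [this]
  apply IsPreconnected.image
  · exact isPreconnected_Ioi.prod isPreconnected_univ
  · apply Continuous.continuousOn
    unfold circleMap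
    fun_prop

/-- the real-linear map `ζ ↦ ζ + c * conj ζ` -/
noncomputable def KQ.L (c : ℂ) : ℂ →ₗ[ℝ] ℂ :=
  LinearMap.id + (LinearMap.mulLeft ℝ c) ∘ₗ Complex.conjAe.toLinearMap

theorem KQ.L_apply (c ζ : ℂ) : KQ.L c ζ = ζ + c * starRingEnd ℂ ζ := by
  simp [KQ.L]

theorem KQ.L_det (c : ℂ) : LinearMap.det (KQ.L c) = 1 - ‖c‖ ^ 2 := by
  rw [← LinearMap.det_toMatrix Complex.basisOneI, Matrix.det_fin_two]
  simp [LinearMap.toMatrix_apply, KQ.L_apply, ← Complex.normSq_eq_norm_sq, Complex.normSq_apply]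
  ring

theorem KQ.L_surj (c w : ℂ) (hc : ‖c‖ ≤ 1 / 2) : ∃ ζ, KQ.L c ζ = w := by
  have hd : LinearMap.det (KQ.L c) ≠ 0 := by
    rw [KQ.L_det]; nlinarith [norm_nonneg c]
  exact (LinearMap.equivOfDetNeZero (KQ.L c) hd).surjective w

theorem KQ.L_vol (c : ℂ) (hc : ‖c‖ ≤ 1 / 2) (S : ℝ) (hS : 0 ≤ S) (a : ℂ) :
    volume ((fun ζ => a + KQ.L c ζ) '' Metric.closedBall 0 S) ≤
      ENNReal.ofReal (Real.pi * S ^ 2) := by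
  have : (fun ζ => a + KQ.L c ζ) '' Metric.closedBall 0 S =
    (fun x => a + x) '' (KQ.L c '' Metric.closedBall 0 S) := by
    rw [image_image]
  rw [this, image_add_left, measure_preimage_add, Measure.addHaar_image_linearMap, KQ.L_det,
    Complex.volume_closedBall]
  have h1 : |1 - ‖c‖ ^ 2| ≤ 1 := by
    rw [abs_le]; constructor <;> nlinarith [norm_nonneg c]
  calc _ ≤ ENNReal.ofReal 1 * (ENNReal.ofReal S ^ 2 * NNReal.pi) := by gcongr
    _ = _ := by
      rw [ENNReal.ofReal_one, one_mul, ENNReal.ofReal_mul Real.pi_pos.le, ENNReal.ofReal_pow hS,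
        mul_comm]
      congr 1
      rw [← NNReal.coe_real_pi, ENNReal.ofReal_coe_nnreal]

theorem KQ.image_subset (ψ : ℂ → ℂ) (hψ : DifferentiableOn ℂ ψ (Metric.ball 0 1))
    (hinj : InjOn (fun z => z⁻¹ + ψ z) {z : ℂ | 0 < ‖z‖ ∧ ‖z‖ < 1})
    (b : ℂ) (C ρ : ℝ) (hC : 0 ≤ C) (hρ : 0 < ρ) (hρ1 : ρ < 1) (hbρ : ‖b‖ * ρ ^ 2 ≤ 1 / 2)
    (hloc : ∀ z : ℂ, ‖z‖ = ρ → ‖ψ z - ψ 0 - b * z‖ ≤ C * ρ ^ 2) :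
    (fun z => z⁻¹ + ψ z) '' {z : ℂ | ρ < ‖z‖ ∧ ‖z‖ < 1} ⊆
      (fun ζ => ψ 0 + KQ.L (b * ρ ^ 2) ζ) '' Metric.closedBall 0 (ρ⁻¹ + 2 * C * ρ ^ 2) := by
  set S := ρ⁻¹ + 2 * C * ρ ^ 2 with hS
  have hS0 : 0 < S := by positivity
  set G : ℂ → ℂ := fun z => z⁻¹ + ψ z with hG
  set c : ℂ := b * ρ ^ 2 with hc
  have hcn : ‖c‖ ≤ 1 / 2 := by
    rw [hc, norm_mul, norm_pow, Complex.norm_real, Real.norm_of_nonneg hρ.le]; exact hbρ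
  set T : ℂ → ℂ := fun ζ => ψ 0 + KQ.L c ζ with hT
  have hTc : Continuous T := by
    simp only [hT, KQ.L_apply]
    fun_prop
  set W : Set ℂ := T '' {ζ : ℂ | S < ‖ζ‖} with hW
  have hWc : IsPreconnected W := (KQ.preconn_outer S hS0).image _ hTc.continuousOn
  set V : Set ℂ := G '' {z : ℂ | 0 < ‖z‖ ∧ ‖z‖ < ρ} with hV
  set K : Set ℂ := G '' {z : ℂ | 0 < ‖z‖ ∧ ‖z‖ ≤ ρ} with hK
  have hDo : IsOpen {z : ℂ | 0 < ‖z‖ ∧ ‖z‖ < ρ} :=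
    (isOpen_lt continuous_const continuous_norm).inter (isOpen_lt continuous_norm continuous_const)
  have hVo : IsOpen V := by
    rw [isOpen_iff_mem_nhds]
    rintro _ ⟨z, hz, rfl⟩
    have hz0 : z ≠ 0 := norm_pos_iff.1 hz.1
    have hzb : Metric.ball (0 : ℂ) 1 ∈ 𝓝 z :=
      Metric.isOpen_ball.mem_nhds (by simpa using hz.2.trans hρ1)
    have han : AnalyticAt ℂ G z := (analyticAt_id.inv hz0).add (hψ.analyticAt hzb)
    have hDn : {z : ℂ | 0 < ‖z‖ ∧ ‖z‖ < ρ} ∈ 𝓝 z := hDo.mem_nhds hz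
    rcases han.eventually_constant_or_nhds_le_map_nhds with h | h
    · exfalso
      have h1 : ∀ᶠ y in 𝓝 z, y = z := by
        filter_upwards [h, hDn] with y hy hyD
        exact hinj ⟨hyD.1, hyD.2.trans hρ1⟩ ⟨hz.1, hz.2.trans hρ1⟩ hy
      have h2 : ∀ᶠ y in 𝓝[≠] z, False := by
        filter_upwards [h1.filter_mono nhdsWithin_le_nhds, self_mem_nhdsWithin] with y h3 h4
        exact h4 h3
      exact h2.exists.elim fun _ => id
    · exact h (image_mem_map hDn)
  have hKc : IsClosed K := by
    have hKe : K = Prod.snd '' {p : Metric.closedBall (0 : ℂ) ρ × ℂ |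
        1 + (p.1 : ℂ) * ψ p.1 = p.2 * p.1} := by
      ext w
      constructor
      · rintro ⟨z, hz, rfl⟩
        have hz0 : z ≠ 0 := norm_pos_iff.1 hz.1
        refine ⟨(⟨z, by simpa using hz.2⟩, G z), ?_, rfl⟩
        simp only [hG, mem_ofPred_eq]
        field_simp
      · rintro ⟨⟨⟨z, hz⟩, w⟩, h, rfl⟩
        simp only [mem_ofPred_eq] at h
        have hz0 : z ≠ 0 := by
          rintro rfl
          simp at h
        refine ⟨z, ⟨norm_pos_iff.2 hz0, by simpa using hz⟩, ?_⟩
        simp only [hG]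
        field_simp
        linear_combination h
    rw [hKe]
    apply isClosedMap_snd_of_compactSpace
    have hψr : Continuous fun p : Metric.closedBall (0 : ℂ) ρ × ℂ => ψ p.1 := by
      refine hψ.continuousOn.comp_continuous (by fun_prop) ?_
      intro p
      exact Metric.closedBall_subset_ball hρ1 p.1.2
    exact isClosed_eq (continuous_const.add ((continuous_subtype_val.comp continuous_fst).mul hψr))
      (by fun_prop)
  have hVK : V ⊆ K := image_mono fun z hz => ⟨hz.1, hz.2.le⟩
  have hbd : ∀ z : ℂ, ‖z‖ = ρ → G z ∉ W := by
    rintro z hz ⟨ζ, hζ, h⟩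
    have hζ' : S < ‖ζ‖ := hζ
    have hz0 : z ≠ 0 := norm_pos_iff.1 (hz ▸ hρ)
    have hcz : starRingEnd ℂ z⁻¹ * ρ ^ 2 = z := by
      have h1 := Complex.mul_conj' z
      rw [hz] at h1
      have h2 : starRingEnd ℂ z ≠ 0 := by simpa using hz0
      rw [← h1, map_inv₀]
      field_simp
    have h1 : (ζ - z⁻¹) + c * starRingEnd ℂ (ζ - z⁻¹) = ψ z - ψ 0 - b * z := by
      simp only [hT, KQ.L_apply, hG] at h
      rw [map_sub]
      linear_combination h - b * hcz
    have h2 := hloc z hz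
    rw [← h1] at h2
    have h3 : ‖ζ - z⁻¹‖ - ‖c * starRingEnd ℂ (ζ - z⁻¹)‖ ≤ C * ρ ^ 2 := by
      refine le_trans ?_ h2
      have := norm_sub_norm_le (ζ - z⁻¹) (-(c * starRingEnd ℂ (ζ - z⁻¹)))
      rwa [norm_neg, sub_neg_eq_add] at this
    rw [norm_mul, RCLike.norm_conj] at h3
    have h4 : ‖ζ‖ ≤ ‖ζ - z⁻¹‖ + ρ⁻¹ := by
      have := norm_add_le (ζ - z⁻¹) z⁻¹
      rwa [sub_add_cancel, norm_inv, hz] at this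
    nlinarith [norm_nonneg (ζ - z⁻¹)]
  have hTs : ∀ w, ∃ ζ, T ζ = w := by
    intro w
    obtain ⟨ζ, hζ⟩ := KQ.L_surj c (w - ψ 0) hcn
    exact ⟨ζ, by simp [hT, hζ]⟩
  have hne : (W ∩ V).Nonempty := by
    have hψc : Tendsto ψ (𝓝[≠] 0) (𝓝 (ψ 0)) :=
      ((hψ.continuousOn.continuousAt (Metric.ball_mem_nhds 0 one_pos)).tendsto).mono_left
        nhdsWithin_le_nhds
    have e1 : ∀ᶠ z in 𝓝[≠] (0 : ℂ), ‖ψ z‖ < ‖ψ 0‖ + 1 :=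
      hψc.norm.eventually (gt_mem_nhds (by linarith))
    have e2 : ∀ᶠ z in 𝓝[≠] (0 : ℂ), 2 * ‖ψ 0‖ + 1 + 2 * S < ‖z⁻¹‖ :=
      (tendsto_norm_cobounded_atTop.comp (tendsto_inv₀_nhdsNE_zero (α := ℂ))).eventually
        (eventually_gt_atTop _)
    have e3 : ∀ᶠ z in 𝓝[≠] (0 : ℂ), ‖z‖ < ρ := by
      have := Metric.ball_mem_nhds (0 : ℂ) hρ
      filter_upwards [nhdsWithin_le_nhds this] with z hz
      simpa using hz
    obtain ⟨z, h1, h2, h3, h4⟩ := (e1.and (e2.and (e3.and self_mem_nhdsWithin))).exists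
    have hz0 : z ≠ 0 := h4
    refine ⟨G z, ?_, z, ⟨norm_pos_iff.2 hz0, h3⟩, rfl⟩
    obtain ⟨ζ, hζ⟩ := hTs (G z)
    refine ⟨ζ, ?_, hζ⟩
    show S < ‖ζ‖
    have h5 : ‖T ζ‖ ≤ ‖ψ 0‖ + 2 * ‖ζ‖ := by
      simp only [hT, KQ.L_apply]
      have a1 := norm_add_le (ψ 0) (ζ + c * starRingEnd ℂ ζ)
      have a2 := norm_add_le ζ (c * starRingEnd ℂ ζ)
      rw [norm_mul, RCLike.norm_conj] at a2
      nlinarith [norm_nonneg ζ]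
    have h6 : ‖z⁻¹‖ - ‖ψ z‖ ≤ ‖G z‖ := by
      have := norm_sub_norm_le (z⁻¹) (-(ψ z))
      rwa [norm_neg, sub_neg_eq_add] at this
    rw [hζ] at h5
    linarith
  have hWV : W ⊆ V := by
    refine hWc.subset_left_of_subset_union hVo hKc.isOpen_compl ?_ ?_ hne
    · exact disjoint_compl_right.mono_left hVK
    · intro w hw
      by_cases hwK : w ∈ K
      · left
        obtain ⟨z, hz, rfl⟩ := hwK
        refine ⟨z, ⟨hz.1, lt_of_le_of_ne hz.2 fun h => hbd z h hw⟩, rfl⟩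
      · exact Or.inr hwK
  rintro _ ⟨a, ha, rfl⟩
  obtain ⟨ζ, hζ⟩ := hTs (G a)
  refine ⟨ζ, ?_, hζ⟩
  rw [mem_closedBall_zero_iff]
  by_contra hcon
  rw [not_le] at hcon
  obtain ⟨z, hz, hza⟩ := hWV ⟨ζ, hcon, hζ⟩
  have := hinj ⟨hz.1, hz.2.trans hρ1⟩ ⟨hρ.trans ha.1, ha.2⟩ hza
  rw [this] at hz
  linarith [hz.2, ha.1]

theorem KQ.dslope_diff (f : ℂ → ℂ) (hf : DifferentiableOn ℂ f (Metric.ball 0 1)) :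
    DifferentiableOn ℂ (dslope f 0) (Metric.ball 0 1) :=
  (Complex.differentiableOn_dslope (Metric.ball_mem_nhds 0 one_pos)).2 hf

theorem KQ.dslope_eq (f : ℂ → ℂ) (z : ℂ) : f z = f 0 + z * dslope f 0 z := by
  have := sub_smul_dslope f 0 z
  simp only [sub_zero, smul_eq_mul] at this
  rw [this]; ring

theorem KQ.area (ψ : ℂ → ℂ) (hψ : DifferentiableOn ℂ ψ (Metric.ball 0 1))
    (hinj : InjOn (fun z => z⁻¹ + ψ z) {z : ℂ | 0 < ‖z‖ ∧ ‖z‖ < 1}) :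
    ‖deriv ψ 0‖ ≤ 1 := by
  set b := deriv ψ 0 with hb
  have hφ : DifferentiableOn ℂ (deriv ψ) (Metric.ball 0 1) := hψ.deriv Metric.isOpen_ball
  -- local bound
  obtain ⟨C, hC0, δ, hδ, hloc⟩ : ∃ C : ℝ, 0 ≤ C ∧ ∃ δ > 0, ∀ z : ℂ, ‖z‖ < δ →
      ‖ψ z - ψ 0 - b * z‖ ≤ C * ‖z‖ ^ 2 := by
    set E := dslope (dslope ψ 0) 0 with hE
    have hEd := KQ.dslope_diff _ (KQ.dslope_diff ψ hψ)
    have hEc : ContinuousAt E 0 :=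
      hEd.continuousOn.continuousAt (Metric.ball_mem_nhds 0 one_pos)
    have hev : ∀ᶠ z in 𝓝 (0 : ℂ), ‖E z‖ < ‖E 0‖ + 1 :=
      hEc.norm.tendsto.eventually (gt_mem_nhds (by linarith))
    obtain ⟨δ, hδ, h⟩ := Metric.eventually_nhds_iff.1 hev
    refine ⟨‖E 0‖ + 1, by positivity, δ, hδ, fun z hz => ?_⟩
    have h1 : ψ z - ψ 0 - b * z = z ^ 2 * E z := by
      have e1 := KQ.dslope_eq ψ z
      have e2 := KQ.dslope_eq (dslope ψ 0) z
      rw [dslope_same, ← hb] at e2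
      rw [e1, e2]; ring
    rw [h1, norm_mul, norm_pow, mul_comm]
    gcongr
    exact (h (by simpa using hz)).le
  have key : ∀ R : ℝ, 0 < R → R < 1 → ∀ᶠ ρ in 𝓝[>] (0 : ℝ),
      -(R ^ 2)⁻¹ + (R ^ 2 - ρ ^ 2) * ‖b‖ ^ 2 ≤ 4 * C * ρ + 4 * C ^ 2 * ρ ^ 4 := by
    intro R hR0 hR1
    have ev1 : ∀ᶠ ρ in 𝓝[>] (0 : ℝ), ‖b‖ * ρ ^ 2 < 1 / 2 := by
      have : Tendsto (fun ρ : ℝ => ‖b‖ * ρ ^ 2) (𝓝 0) (𝓝 (‖b‖ * 0 ^ 2)) :=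
        Continuous.tendsto (by fun_prop) 0
      exact (this.mono_left nhdsWithin_le_nhds).eventually (gt_mem_nhds (by norm_num))
    have ev2 : ∀ᶠ ρ in 𝓝[>] (0 : ℝ), ρ < R := nhdsWithin_le_nhds (gt_mem_nhds hR0)
    have ev3 : ∀ᶠ ρ in 𝓝[>] (0 : ℝ), ρ < δ := nhdsWithin_le_nhds (gt_mem_nhds hδ)
    filter_upwards [ev1, ev2, ev3, self_mem_nhdsWithin] with ρ h1 h2 h3 h4
    have hρ : 0 < ρ := h4
    have hlow := KQ.annulus_lower (deriv ψ) hφ ρ R hρ h2 hR1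
    set A : Set ℂ := {z : ℂ | ρ < ‖z‖ ∧ ‖z‖ < R} with hA
    have hAo : IsOpen A := (isOpen_lt continuous_const continuous_norm).inter
      (isOpen_lt continuous_norm continuous_const)
    have hA0 : A ⊆ {z : ℂ | 0 < ‖z‖ ∧ ‖z‖ < 1} := fun z hz => ⟨hρ.trans hz.1, hz.2.trans hR1⟩
    have hA1 : A ⊆ {z : ℂ | ρ < ‖z‖ ∧ ‖z‖ < 1} := fun z hz => ⟨hz.1, hz.2.trans hR1⟩
    have hder : ∀ z ∈ A, HasFDerivWithinAt (fun z => z⁻¹ + ψ z)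
        ((-(z ^ 2)⁻¹ + deriv ψ z) • (1 : ℂ →L[ℝ] ℂ)) A z := by
      intro z hz
      have hz0 : z ≠ 0 := norm_pos_iff.1 (hρ.trans hz.1)
      have hzd : HasDerivAt ψ (deriv ψ z) z :=
        (hψ.differentiableAt (Metric.isOpen_ball.mem_nhds
          (by simpa using hz.2.trans hR1))).hasDerivAt
      exact ((hasDerivAt_inv hz0).add hzd).complexToReal_fderiv.hasFDerivWithinAt
    have hdet : ∀ a : ℂ, |(a • (1 : ℂ →L[ℝ] ℂ)).det| = ‖a‖ ^ 2 := by
      intro a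
      have : (a • (1 : ℂ →L[ℝ] ℂ)).det = ‖a‖ ^ 2 := by
        rw [ContinuousLinearMap.det, ← LinearMap.det_toMatrix Complex.basisOneI,
          Matrix.det_fin_two]
        simp [LinearMap.toMatrix_apply, ← Complex.normSq_eq_norm_sq, Complex.normSq_apply]
      rw [this, abs_of_nonneg (by positivity)]
    have harea := lintegral_abs_det_fderiv_eq_addHaar_image volume hAo.measurableSet hder
      (hinj.mono hA0)
    simp only [hdet] at harea
    have hsub := KQ.image_subset ψ hψ hinj b C ρ hC0 hρ (h2.trans hR1) h1.le
      (fun z hz => by rw [← hz]; exact hloc z (hz ▸ h3))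
    have hcn : ‖b * (ρ : ℂ) ^ 2‖ ≤ 1 / 2 := by
      rw [norm_mul, norm_pow, Complex.norm_real, Real.norm_of_nonneg hρ.le]; exact h1.le
    have hup := KQ.L_vol (b * ρ ^ 2) hcn (ρ⁻¹ + 2 * C * ρ ^ 2) (by positivity) (ψ 0)
    rw [harea] at hlow
    have hfin := (hlow.trans (measure_mono ((image_mono hA1).trans
      hsub))).trans hup
    rw [ENNReal.ofReal_le_ofReal_iff (by positivity)] at hfin
    have hfin := le_of_mul_le_mul_left hfin Real.pi_pos
    have he : (ρ⁻¹ + 2 * C * ρ ^ 2) ^ 2 = (ρ ^ 2)⁻¹ + 4 * C * ρ + 4 * C ^ 2 * ρ ^ 4 := by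
      field_simp; ring
    rw [he] at hfin
    linarith
  have key2 : ∀ R : ℝ, 0 < R → R < 1 → -(R ^ 2)⁻¹ + R ^ 2 * ‖b‖ ^ 2 ≤ 0 := by
    intro R hR0 hR1
    have t1 : Tendsto (fun ρ : ℝ => -(R ^ 2)⁻¹ + (R ^ 2 - ρ ^ 2) * ‖b‖ ^ 2) (𝓝[>] 0)
        (𝓝 (-(R ^ 2)⁻¹ + (R ^ 2 - 0 ^ 2) * ‖b‖ ^ 2)) :=
      (Continuous.tendsto (by fun_prop) 0).mono_left nhdsWithin_le_nhds
    have t2 : Tendsto (fun ρ : ℝ => 4 * C * ρ + 4 * C ^ 2 * ρ ^ 4) (𝓝[>] 0)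
        (𝓝 (4 * C * 0 + 4 * C ^ 2 * 0 ^ 4)) :=
      (Continuous.tendsto (by fun_prop) 0).mono_left nhdsWithin_le_nhds
    have := le_of_tendsto_of_tendsto t1 t2 (key R hR0 hR1)
    simpa using this
  have key3 : ∀ R : ℝ, 0 < R → R < 1 → R ^ 4 * ‖b‖ ^ 2 ≤ 1 := by
    intro R hR0 hR1
    have := key2 R hR0 hR1
    have h2 : R ^ 2 * (-(R ^ 2)⁻¹ + R ^ 2 * ‖b‖ ^ 2) ≤ 0 :=
      mul_nonpos_of_nonneg_of_nonpos (by positivity) this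
    rw [mul_add, mul_neg, mul_inv_cancel₀ (by positivity)] at h2
    linarith
  have t : Tendsto (fun R : ℝ => R ^ 4 * ‖b‖ ^ 2) (𝓝[<] 1) (𝓝 (1 ^ 4 * ‖b‖ ^ 2)) :=
    (Continuous.tendsto (by fun_prop) 1).mono_left nhdsWithin_le_nhds
  have hlim := le_of_tendsto t (b := 1) (by
    filter_upwards [self_mem_nhdsWithin, nhdsWithin_le_nhds (lt_mem_nhds (zero_lt_one (α := ℝ)))]
      with R h1 h2
    exact key3 R h2 h1)
  rw [one_pow, one_mul] at hlim
  exact (sq_le_one_iff₀ (norm_nonneg b)).1 hlim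

/-- holomorphic square root on the disk -/
theorem KQ.sqrt (k : ℂ → ℂ) (hk : DifferentiableOn ℂ k (Metric.ball 0 1)) (hk0 : k 0 = 1)
    (hne : ∀ z ∈ Metric.ball (0 : ℂ) 1, k z ≠ 0) :
    ∃ q : ℂ → ℂ, DifferentiableOn ℂ q (Metric.ball 0 1) ∧ q 0 = 1 ∧
      ∀ z ∈ Metric.ball (0 : ℂ) 1, q z ^ 2 = k z := by
  have hd : DifferentiableOn ℂ (fun z => deriv k z / k z) (Metric.ball 0 1) :=
    (hk.deriv Metric.isOpen_ball).div hk hne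
  obtain ⟨l, hl⟩ := hd.isExactOn_ball.with_val_at 0 0
  obtain ⟨hl0, hl⟩ := hl
  have hld : ∀ z ∈ Metric.ball (0 : ℂ) 1, HasDerivAt l (deriv k z / k z) z := hl
  refine ⟨fun z => Complex.exp (l z / 2), ?_, by simp [hl0], ?_⟩
  · intro z hz
    exact ((hld z hz).differentiableAt.div_const 2).cexp.differentiableWithinAt
  · intro z hz
    have hconst : ∀ y ∈ Metric.ball (0 : ℂ) 1,
        HasDerivAt (fun y => k y * Complex.exp (-l y)) 0 y := by
      intro y hy
      have h1 : HasDerivAt k (deriv k y) y :=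
        (hk.differentiableAt (Metric.isOpen_ball.mem_nhds hy)).hasDerivAt
      have := h1.mul (hld y hy).neg.cexp
      convert! this using 1
      have := hne y hy
      field_simp
      ring
    have h2 := (convex_ball (0 : ℂ) 1).is_const_of_fderivWithin_eq_zero (𝕜 := ℂ)
      (f := fun y => k y * Complex.exp (-l y))
      (fun y hy => (hconst y hy).differentiableAt.differentiableWithinAt)
      (fun y hy => by
        rw [fderivWithin_of_isOpen Metric.isOpen_ball hy]
        ext
        simp [(hconst y hy).deriv]) hz
      (Metric.mem_ball_self one_pos)
    simp only [hk0, hl0, neg_zero, Complex.exp_zero, mul_one] at h2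
    have h3 : Complex.exp (l z / 2) ^ 2 = Complex.exp (l z) := by
      rw [← Complex.exp_nat_mul]; congr 1; push_cast; ring
    show Complex.exp (l z / 2) ^ 2 = k z
    rw [h3]
    rw [Complex.exp_neg] at h2
    have := Complex.exp_ne_zero (l z)
    field_simp at h2
    exact h2.symm

theorem KQ.coeff (k : ℂ → ℂ) (hk : DifferentiableOn ℂ k (Metric.ball 0 1)) (hk0 : k 0 = 1)
    (hinj : InjOn (fun z => z * k z) (Metric.ball 0 1)) : ‖deriv k 0‖ ≤ 2 := by
  have h0m : (0 : ℂ) ∈ Metric.ball (0 : ℂ) 1 := Metric.mem_ball_self one_pos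
  have hne : ∀ z ∈ Metric.ball (0 : ℂ) 1, k z ≠ 0 := by
    intro z hz h
    have hz0 : z = 0 := hinj hz h0m (by simp [h])
    rw [hz0, hk0] at h
    exact one_ne_zero h
  obtain ⟨q, hq, hq0, hqk⟩ := KQ.sqrt k hk hk0 hne
  have hqne : ∀ z ∈ Metric.ball (0 : ℂ) 1, q z ≠ 0 := by
    intro z hz h
    apply hne z hz
    rw [← hqk z hz, h]; simp
  set p : ℂ → ℂ := fun z => (q z)⁻¹ with hp
  have hpd : DifferentiableOn ℂ p (Metric.ball 0 1) := hq.inv hqne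
  have hp0 : p 0 = 1 := by simp [hp, hq0]
  have hqD : HasDerivAt q (deriv q 0) 0 :=
    (hq.differentiableAt (Metric.isOpen_ball.mem_nhds h0m)).hasDerivAt
  have hkder : deriv k 0 = 2 * deriv q 0 := by
    have h1 : (fun z => q z ^ 2) =ᶠ[𝓝 0] k := by
      filter_upwards [Metric.isOpen_ball.mem_nhds h0m] with z hz using hqk z hz
    rw [← h1.deriv_eq]
    refine Eq.trans (hqD.pow 2).deriv ?_
    rw [hq0]
    simp
  have hpder : deriv p 0 = -deriv q 0 := by
    refine Eq.trans (hqD.inv (by rw [hq0]; exact one_ne_zero)).deriv ?_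
    rw [hq0]
    simp
  set s := dslope p 0 with hs
  have hsd : DifferentiableOn ℂ s (Metric.ball 0 1) := KQ.dslope_diff p hpd
  have hsq : ∀ z ∈ Metric.ball (0 : ℂ) 1, z ^ 2 ∈ Metric.ball (0 : ℂ) 1 := by
    intro z hz
    rw [mem_ball_zero_iff] at hz ⊢
    rw [norm_pow]
    exact pow_lt_one₀ (norm_nonneg z) hz two_ne_zero
  set ψ : ℂ → ℂ := fun z => z * s (z ^ 2) with hψ
  have hs2 : DifferentiableOn ℂ (fun z => s (z ^ 2)) (Metric.ball 0 1) :=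
    hsd.comp (by fun_prop) hsq
  have hψd : DifferentiableOn ℂ ψ (Metric.ball 0 1) := differentiableOn_id.mul hs2
  have hψder : deriv ψ 0 = deriv p 0 := by
    have h1 : HasDerivAt (fun z => s (z ^ 2)) (deriv (fun z => s (z ^ 2)) 0) 0 :=
      (hs2.differentiableAt (Metric.isOpen_ball.mem_nhds h0m)).hasDerivAt
    have := ((hasDerivAt_id (0 : ℂ)).mul h1).deriv
    have h2 : deriv ψ 0 = 1 * s (0 ^ 2) + 0 * deriv (fun z => s (z ^ 2)) 0 := this
    rw [h2]
    simp [hs]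
  have hG : ∀ z : ℂ, z ≠ 0 → z⁻¹ + ψ z = (z * q (z ^ 2))⁻¹ := by
    intro z hz
    have := KQ.dslope_eq p (z ^ 2)
    rw [hp0, ← hs] at this
    rw [mul_inv, show (q (z ^ 2))⁻¹ = p (z ^ 2) from rfl, this, hψ]
    field_simp
  have harea := KQ.area ψ hψd (by
    intro z hz w hw h
    simp only at h
    have hz0 : z ≠ 0 := norm_pos_iff.1 hz.1
    have hw0 : w ≠ 0 := norm_pos_iff.1 hw.1
    have hzb : z ∈ Metric.ball (0 : ℂ) 1 := by simpa using hz.2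
    have hwb : w ∈ Metric.ball (0 : ℂ) 1 := by simpa using hw.2
    rw [hG z hz0, hG w hw0, inv_inj] at h
    have h2 : z ^ 2 = w ^ 2 := by
      apply hinj (hsq z hzb) (hsq w hwb)
      simp only
      rw [← hqk _ (hsq z hzb), ← hqk _ (hsq w hwb), ← mul_pow, ← mul_pow, h]
    rw [h2] at h
    exact mul_right_cancel₀ (hqne _ (hsq w hwb)) h)
  rw [hψder, hpder, norm_neg] at harea
  rw [hkder, norm_mul, Complex.norm_ofNat]
  linarith

theorem KQ.koebe (k : ℂ → ℂ) (hk : DifferentiableOn ℂ k (Metric.ball 0 1)) (hk0 : k 0 = 1)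
    (hinj : InjOn (fun z => z * k z) (Metric.ball 0 1)) (w : ℂ) (hw : ‖w‖ < 1 / 4) :
    ∃ z ∈ Metric.ball (0 : ℂ) 1, z * k z = w := by
  by_contra hcon
  push Not at hcon
  have h0m : (0 : ℂ) ∈ Metric.ball (0 : ℂ) 1 := Metric.mem_ball_self one_pos
  have hw0 : w ≠ 0 := by
    rintro rfl
    exact hcon 0 h0m (by simp)
  have h1 := KQ.coeff k hk hk0 hinj
  have hden : ∀ z ∈ Metric.ball (0 : ℂ) 1, 1 - z * k z / w ≠ 0 := by
    intro z hz h
    apply hcon z hz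
    field_simp at h
    linear_combination -h
  have hdd : DifferentiableOn ℂ (fun z => 1 - z * k z / w) (Metric.ball 0 1) := by
    have := differentiableOn_id.mul hk
    exact (differentiableOn_const 1).sub (this.div_const w)
  have h2 := KQ.coeff (fun z => k z / (1 - z * k z / w)) (hk.div hdd hden) (by simp [hk0]) (by
    intro x hx y hy h
    apply hinj hx hy
    have hx' := hden x hx
    have hy' := hden y hy
    simp only at h ⊢
    rw [← mul_div_assoc, ← mul_div_assoc, div_eq_div_iff hx' hy'] at h
    linear_combination h)
  have hkD : HasDerivAt k (deriv k 0) 0 :=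
    (hk.differentiableAt (Metric.isOpen_ball.mem_nhds h0m)).hasDerivAt
  have hD : deriv (fun z => k z / (1 - z * k z / w)) 0 = deriv k 0 + 1 / w := by
    have ha := (((hasDerivAt_id (0 : ℂ)).mul hkD).div_const w).const_sub 1
    have := (hkD.div ha (by simp)).deriv
    refine Eq.trans this ?_
    simp [hk0]
  rw [hD] at h2
  have h3 : ‖1 / w‖ ≤ 4 := by
    have := norm_sub_le (deriv k 0 + 1 / w) (deriv k 0)
    rw [add_sub_cancel_left] at this
    linarith
  rw [norm_div, norm_one, div_le_iff₀ (norm_pos_iff.2 hw0)] at h3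
  linarith

end KoebeQuarter

/-- Koebe quarter theorem applied to the induced map: if `g : ℍ → ℂ` is injective
holomorphic with `g(z+1)=g(z)+1`, `h` is the induced univalent map on the unit disk
(`h (exp (2πi z)) = exp (2πi g z)`, `h 0 = 0`), and `α` satisfies `exp(-2πiα) = h'(0)`,
then every `w` with `Im w > (log 2)/π - Im α` lies in `g(ℍ)`. -/
theorem stmt5 (g h : ℂ → ℂ) (α : ℂ)
    (hgdiff : DifferentiableOn ℂ g {z : ℂ | 0 < z.im})
    (hginj : Set.InjOn g {z : ℂ | 0 < z.im})
    (hper : ∀ z : ℂ, 0 < z.im → g (z + 1) = g z + 1)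
    (hhdiff : DifferentiableOn ℂ h (Metric.ball (0 : ℂ) 1))
    (hhinj : Set.InjOn h (Metric.ball (0 : ℂ) 1))
    (hh0 : h 0 = 0)
    (hrel : ∀ z : ℂ, 0 < z.im →
      h (Complex.exp (2 * Real.pi * Complex.I * z)) =
        Complex.exp (2 * Real.pi * Complex.I * g z))
    (hα : Complex.exp (-(2 * Real.pi * Complex.I * α)) = deriv h 0) :
    ∀ w : ℂ, Real.log 2 / Real.pi - α.im < w.im → w ∈ g '' {z : ℂ | 0 < z.im} := by
  intro w hw
  have h0m : (0 : ℂ) ∈ Metric.ball (0 : ℂ) 1 := Metric.mem_ball_self one_pos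
  set a := deriv h 0 with ha
  have ha0 : a ≠ 0 := by rw [← hα]; exact Complex.exp_ne_zero _
  have han : ‖a‖ = Real.exp (2 * Real.pi * α.im) := by
    rw [← hα, Complex.norm_exp]; congr 1; simp
  have hwn : ‖Complex.exp (2 * Real.pi * Complex.I * w)‖ = Real.exp (-(2 * Real.pi * w.im)) := by
    rw [Complex.norm_exp]; congr 1; simp
  have hlt : ‖Complex.exp (2 * Real.pi * Complex.I * w) / a‖ < 1 / 4 := by
    rw [norm_div, hwn, han, ← Real.exp_sub]
    have h4 : (1 / 4 : ℝ) = Real.exp (-(2 * Real.log 2)) := by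
      rw [Real.exp_neg, two_mul, Real.exp_add, Real.exp_log (by norm_num)]; norm_num
    rw [h4, Real.exp_lt_exp]
    have hpi := Real.pi_pos
    have h5 : Real.log 2 / Real.pi * Real.pi = Real.log 2 := by field_simp
    nlinarith
  obtain ⟨ζ, hζ, hζw⟩ := KQ.koebe (fun z => dslope h 0 z / a)
    ((KQ.dslope_diff h hhdiff).div_const a) (by simp [← ha, ha0]) (by
      intro x hx y hy hxy
      apply hhinj hx hy
      rw [KQ.dslope_eq h x, KQ.dslope_eq h y]
      simp only at hxy
      field_simp at hxy
      rw [hxy]) _ hlt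
  have hhζ : h ζ = Complex.exp (2 * Real.pi * Complex.I * w) := by
    rw [KQ.dslope_eq h ζ, hh0, zero_add]
    field_simp at hζw
    exact hζw
  have hζ0 : ζ ≠ 0 := by
    rintro rfl
    rw [hh0] at hhζ
    exact Complex.exp_ne_zero _ hhζ.symm
  have h2pi : (2 * Real.pi * Complex.I : ℂ) ≠ 0 := Complex.two_pi_I_ne_zero
  set z : ℂ := Complex.log ζ / (2 * Real.pi * Complex.I) with hz
  have hez : Complex.exp (2 * Real.pi * Complex.I * z) = ζ := by
    rw [hz, mul_div_cancel₀ _ h2pi, Complex.exp_log hζ0]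
  have hzim : 0 < z.im := by
    have h1 : ‖Complex.exp (2 * Real.pi * Complex.I * z)‖ = Real.exp (-(2 * Real.pi * z.im)) := by
      rw [Complex.norm_exp]; congr 1; simp
    rw [hez] at h1
    rw [mem_ball_zero_iff, h1, Real.exp_lt_one_iff] at hζ
    have hpi := Real.pi_pos
    by_contra hcon
    nlinarith
  have hrz := hrel z hzim
  rw [hez, hhζ, Complex.exp_eq_exp_iff_exists_int] at hrz
  obtain ⟨n, hn⟩ := hrz
  have hwn : w = g z + n := by
    apply mul_left_cancel₀ h2pi
    rw [hn]; ring
  have hnat : ∀ (m : ℕ) (y : ℂ), 0 < y.im → g (y + m) = g y + m := by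
    intro m y hy
    induction m with
    | zero => simp
    | succ m ih =>
      push_cast
      rw [← add_assoc, hper _ (by simpa using hy), ih, add_assoc]
  have hint : g (z + n) = g z + n := by
    obtain ⟨m, rfl | rfl⟩ := n.eq_nat_or_neg
    · exact_mod_cast hnat m z hzim
    · have := hnat m (z + ((-(m : ℤ) : ℤ) : ℂ)) (by simpa using hzim)
      push_cast at this ⊢
      rw [neg_add_cancel_right] at this
      linear_combination -this
  exact ⟨z + n, by simpa using hzim, by rw [hint, hwn]⟩
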